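/- Let k ≥ 2 and let ω be a Hermitian matrix on ℂ^{dA} ⊗ ℂ^{dB}. Then the support function of PPT_k(A:B) has the dual semidefinite-programming expression: h_{PPT_k(A:B)}(ω) = inf{ t ≥ 0 : there exist positive semidefinite α₁,…,α_k, β₁,…,β_k with ω ≤ β₁^{T_B} − α₁^{T_B}, α_{i−1} + β_{i−1} ≤ β_i^{T_B} − α_i^{T_B} for all 2 ≤ i ≤ k, and α_k + β_k ≤ t·I }. -/

import Mathlib

open scoped Kronecker ComplexOrder Matrix

attribute [local instance] Classical.propDecidable

noncomputable section

namespace QIT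

variable {n : Type*} [Fintype n] [DecidableEq n]

/-- Base-2 matrix logarithm taken on the support (junk value `0` for non-Hermitian input). -/
def matLog (A : Matrix n n ℂ) : Matrix n n ℂ :=
  if hA : A.IsHermitian then
    (hA.eigenvectorUnitary : Matrix n n ℂ) *
      Matrix.diagonal (fun i => if hA.eigenvalues i = 0 then (0 : ℂ)
        else (Real.logb 2 (hA.eigenvalues i) : ℂ)) *
      (hA.eigenvectorUnitary : Matrix n n ℂ)ᴴ
  else 0

/-- Orthogonal projection onto the support of a Hermitian matrix. -/
def suppProj (A : Matrix n n ℂ) : Matrix n n ℂ :=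
  if hA : A.IsHermitian then
    (hA.eigenvectorUnitary : Matrix n n ℂ) *
      Matrix.diagonal (fun i => if hA.eigenvalues i = 0 then (0 : ℂ) else 1) *
      (hA.eigenvectorUnitary : Matrix n n ℂ)ᴴ
  else 0

/-- Support inclusion `supp ρ ⊆ supp σ`, phrased via kernels. -/
def suppLE (ρ σ : Matrix n n ℂ) : Prop :=
  ∀ x : n → ℂ, σ.mulVec x = 0 → ρ.mulVec x = 0

/-- Umegaki relative entropy (base 2), `+∞` when supports are not included. -/
def relEnt (ρ σ : Matrix n n ℂ) : EReal :=
  if suppLE ρ σ then (((ρ * (matLog ρ - matLog σ)).trace).re : EReal) else ⊤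

/-- Classical relative-entropy summand `p log₂(p/q)` with conventions
`0 · log(0/q) = 0` and `p · log(p/0) = +∞` for `p ≠ 0`. -/
def klTerm (p q : ℝ) : EReal :=
  if p = 0 then 0 else if q = 0 then ⊤ else ((p * Real.logb 2 (p / q) : ℝ) : EReal)

/-- A finite POVM. -/
def IsPOVM {m : ℕ} (M : Fin m → Matrix n n ℂ) : Prop :=
  (∀ x, (M x).PosSemidef) ∧ ∑ x, M x = 1

/-- Measured relative entropy (base 2). -/
def measRelEnt (ρ σ : Matrix n n ℂ) : EReal :=
  ⨆ (m : ℕ) (M : Fin m → Matrix n n ℂ) (_ : IsPOVM M),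
    ∑ x, klTerm ((M x * ρ).trace).re ((M x * σ).trace).re

/-- Trace norm: sum of singular values. -/
def traceNorm (A : Matrix n n ℂ) : ℝ :=
  ∑ i, Real.sqrt ((Matrix.posSemidef_conjTranspose_mul_self A).1.eigenvalues i)

/-- Operator (spectral) norm: largest singular value. -/
def opNorm (A : Matrix n n ℂ) : ℝ :=
  ⨆ i, Real.sqrt ((Matrix.posSemidef_conjTranspose_mul_self A).1.eigenvalues i)

/-- Partial transpose on the second tensor factor. -/
def ptB {α β : Type*} (X : Matrix (α × β) (α × β) ℂ) : Matrix (α × β) (α × β) ℂ :=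
  Matrix.of fun p q => X (p.1, q.2) (q.1, p.2)

/-- Kronecker product of two bipartite matrices, reindexed to the bipartition (A×A') : (B×B'). -/
def kron2 {α β γ δ : Type*} (X : Matrix (α × β) (α × β) ℂ) (Y : Matrix (γ × δ) (γ × δ) ℂ) :
    Matrix ((α × γ) × β × δ) ((α × γ) × β × δ) ℂ :=
  Matrix.reindex (Equiv.prodProdProdComm α β γ δ) (Equiv.prodProdProdComm α β γ δ) (X ⊗ₖ Y)

/-- The permutation unitary on `(ℂ^d)^{⊗ m}`. -/
def permMat (d m : ℕ) (π : Equiv.Perm (Fin m)) :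
    Matrix (Fin m → Fin d) (Fin m → Fin d) ℂ :=
  Matrix.of fun f g => if f ∘ π = g then 1 else 0

/-- Membership in the `PPT_k` set. -/
def memPPTk {α β : Type*} [Fintype α] [Fintype β] [DecidableEq α] [DecidableEq β]
    (k : ℕ) (X : Matrix (α × β) (α × β) ℂ) : Prop :=
  X.PosSemidef ∧ ∃ ω : ℕ → Matrix (α × β) (α × β) ℂ,
    ω 1 = X ∧ (∀ i ∈ Finset.Icc 1 k, (ω i).IsHermitian) ∧
    (∀ i ∈ Finset.Icc 1 (k - 1),
      ((ω (i + 1)) - ptB (ω i)).PosSemidef ∧ ((ω (i + 1)) + ptB (ω i)).PosSemidef) ∧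
    traceNorm (ptB (ω k)) ≤ 1

/-- Membership in the Rains set. -/
def memRains {α β : Type*} [Fintype α] [Fintype β] [DecidableEq α] [DecidableEq β]
    (σ : Matrix (α × β) (α × β) ℂ) : Prop :=
  σ.PosSemidef ∧ traceNorm (ptB σ) ≤ 1


open Matrix

/-- The Farkas lemma for a convex cone, under a Slater-type condition. -/
lemma exists_nonneg_representation {V W : Type*} [AddCommGroup V] [Module ℝ V] [AddCommGroup W]
    [Module ℝ W] (C : PointedCone ℝ W) (A : V →ₗ[ℝ] W) (c : V →ₗ[ℝ] ℝ)
    (hc : ∀ x, A x ∈ C → 0 ≤ c x) (hA : ∀ w, ∃ x, A x + w ∈ C) :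
    ∃ φ : W →ₗ[ℝ] ℝ, (∀ w ∈ C, 0 ≤ φ w) ∧ ∀ x, c x = φ (A x) := by
  let L : V × W →ₗ[ℝ] W := A.coprod LinearMap.id
  let f : (V × W) →ₗ.[ℝ] ℝ :=
    ⟨LinearMap.ker (LinearMap.snd ℝ V W),
      (c ∘ₗ LinearMap.fst ℝ V W) ∘ₗ (LinearMap.ker (LinearMap.snd ℝ V W)).subtype⟩
  obtain ⟨g, hgf, hg⟩ := riesz_extension (C.comap L) f
    (by
      rintro ⟨⟨x, w⟩, hw⟩ hx
      have hw : w = 0 := hw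
      subst hw
      exact hc x (by simpa [L] using hx))
    (by
      rintro ⟨x, w⟩
      obtain ⟨z, hz⟩ := hA (A x + w)
      refine ⟨⟨(z, 0), by simp [f]⟩, ?_⟩
      simpa [L, add_assoc] using hz)
  have hgL (x : V) (w : W) : g (x, w) = c x + g (0, w) := by
    have h1 : g (x, 0) = c x := hgf ⟨(x, 0), by simp [f]⟩
    rw [← h1, ← map_add]
    simp
  have hle (x : V) : 0 ≤ g (x, -A x) := hg _ (by simp [L])
  refine ⟨g ∘ₗ LinearMap.inr ℝ V W, fun w hw => hg _ (by simpa [L] using hw), fun x => ?_⟩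
  have h1 := hle x
  have h2 := hle (-x)
  have h3 : g (0, -A x) = -g (0, A x) := by
    rw [← map_neg g, Prod.neg_mk, neg_zero]
  rw [hgL, h3] at h1
  rw [hgL] at h2
  simp only [map_neg, neg_neg] at h2
  simp only [LinearMap.comp_apply, LinearMap.inr_apply]
  linarith

open scoped MatrixOrder Matrix.Norms.L2Operator in
lemma posSemidef_trace_mul_re_nonneg {A B : Matrix n n ℂ} (hA : A.PosSemidef)
    (hB : B.PosSemidef) : 0 ≤ ((A * B).trace).re := by
  obtain ⟨R, rfl⟩ := CStarAlgebra.nonneg_iff_eq_star_mul_self.mp hB.nonneg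
  rw [star_eq_conjTranspose, ← Matrix.mul_assoc, Matrix.trace_mul_comm, ← Matrix.mul_assoc]
  exact (Complex.le_def.mp (hA.mul_mul_conjTranspose_same R).trace_nonneg).1

lemma _root_.Matrix.IsHermitian.eq_mul_diagonal_mul {H : Matrix n n ℂ} (hH : H.IsHermitian) :
    H = (hH.eigenvectorUnitary : Matrix n n ℂ) * diagonal (fun i => (hH.eigenvalues i : ℂ)) *
      (hH.eigenvectorUnitary : Matrix n n ℂ)ᴴ := by
  conv_lhs => rw [hH.spectral_theorem]
  rfl

lemma conjTranspose_mul_eigenvectorUnitary {H : Matrix n n ℂ} (hH : H.IsHermitian) :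
    (hH.eigenvectorUnitary : Matrix n n ℂ)ᴴ * (hH.eigenvectorUnitary : Matrix n n ℂ) = 1 :=
  Unitary.coe_star_mul_self _

lemma eigenvectorUnitary_mul_conjTranspose {H : Matrix n n ℂ} (hH : H.IsHermitian) :
    (hH.eigenvectorUnitary : Matrix n n ℂ) * (hH.eigenvectorUnitary : Matrix n n ℂ)ᴴ = 1 :=
  Unitary.coe_mul_star_self _

/-- The trace norm of a Hermitian matrix is the sum of the absolute values of its eigenvalues. -/
lemma traceNorm_eq_sum_abs_eigenvalues {H : Matrix n n ℂ} (hH : H.IsHermitian) :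
    traceNorm H = ∑ i, |hH.eigenvalues i| := by
  have hsq : Hᴴ * H = (hH.eigenvectorUnitary : Matrix n n ℂ) *
      diagonal (fun i => ((hH.eigenvalues i ^ 2 : ℝ) : ℂ)) *
      (hH.eigenvectorUnitary : Matrix n n ℂ)ᴴ := by
    rw [hH.eq]
    conv_lhs => rw [hH.eq_mul_diagonal_mul]
    set U := (hH.eigenvectorUnitary : Matrix n n ℂ)
    calc _ = U * diagonal (fun i => (hH.eigenvalues i : ℂ)) * (Uᴴ * U) *
          diagonal (fun i => (hH.eigenvalues i : ℂ)) * Uᴴ := by simp only [Matrix.mul_assoc]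
      _ = _ := by
        rw [conjTranspose_mul_eigenvectorUnitary, Matrix.mul_one, Matrix.mul_assoc U,
          diagonal_mul_diagonal]
        simp [sq]
  have hroots := (posSemidef_conjTranspose_mul_self H).1.roots_charpoly_eq_eigenvalues
  have hchar : (Hᴴ * H).charpoly =
      (diagonal (fun i => ((hH.eigenvalues i ^ 2 : ℝ) : ℂ))).charpoly := by
    rw [hsq, charpoly_mul_comm, ← Matrix.mul_assoc, conjTranspose_mul_eigenvectorUnitary,
      Matrix.one_mul]
  rw [hchar, charpoly_diagonal, Polynomial.roots_prod _ _ (Finset.prod_ne_zero_iff.mpr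
    fun _ _ => Polynomial.X_sub_C_ne_zero _)] at hroots
  have h := congrArg (fun m => (m.map (fun z : ℂ => √z.re)).sum) hroots
  simp only [Polynomial.roots_X_sub_C, Multiset.bind_singleton, Multiset.map_map] at h
  simp only [Function.comp_def, Complex.ofReal_re, Real.sqrt_sq_eq_abs] at h
  exact h.symm

lemma posSemidef_eigenvectorUnitary_conj {H : Matrix n n ℂ} (hH : H.IsHermitian) {d : n → ℝ}
    (hd : ∀ i, 0 ≤ d i) :
    ((hH.eigenvectorUnitary : Matrix n n ℂ) * diagonal (fun i => (d i : ℂ)) *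
      (hH.eigenvectorUnitary : Matrix n n ℂ)ᴴ).PosSemidef :=
  (posSemidef_diagonal_iff.mpr fun i => by exact_mod_cast hd i).mul_mul_conjTranspose_same _

lemma exists_posSemidef_trace_eq_traceNorm {H : Matrix n n ℂ} (hH : H.IsHermitian) :
    ∃ P : Matrix n n ℂ, (P - H).PosSemidef ∧ (P + H).PosSemidef ∧ P.trace.re = traceNorm H := by
  refine ⟨(hH.eigenvectorUnitary : Matrix n n ℂ) *
    diagonal (fun i => ((|hH.eigenvalues i| : ℝ) : ℂ)) *
    (hH.eigenvectorUnitary : Matrix n n ℂ)ᴴ, ?_, ?_, ?_⟩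
  · convert posSemidef_eigenvectorUnitary_conj hH
      (d := fun i => |hH.eigenvalues i| - hH.eigenvalues i)
      (fun i => sub_nonneg.mpr (le_abs_self _)) using 1
    refine (congrArg (_ - ·) hH.eq_mul_diagonal_mul).trans ?_
    rw [← Matrix.sub_mul, ← Matrix.mul_sub, diagonal_sub]
    simp
  · convert posSemidef_eigenvectorUnitary_conj hH
      (d := fun i => |hH.eigenvalues i| + hH.eigenvalues i)
      (fun i => by linarith [neg_abs_le (hH.eigenvalues i)]) using 1
    refine (congrArg (_ + ·) hH.eq_mul_diagonal_mul).trans ?_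
    rw [← Matrix.add_mul, ← Matrix.mul_add, diagonal_add]
    simp
  · rw [traceNorm_eq_sum_abs_eigenvalues hH, trace_mul_comm, ← Matrix.mul_assoc,
      conjTranspose_mul_eigenvectorUnitary, Matrix.one_mul, trace_diagonal]
    simp

lemma traceNorm_le_of_posSemidef {H P : Matrix n n ℂ} (hH : H.IsHermitian)
    (h₁ : (P - H).PosSemidef) (h₂ : (P + H).PosSemidef) : traceNorm H ≤ P.trace.re := by
  set U := (hH.eigenvectorUnitary : Matrix n n ℂ) with hU
  have hdiag : Uᴴ * H * U = diagonal (fun i => (hH.eigenvalues i : ℂ)) := by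
    conv_lhs => rw [hH.eq_mul_diagonal_mul]
    rw [← hU, ← Matrix.mul_assoc, ← Matrix.mul_assoc, conjTranspose_mul_eigenvectorUnitary,
      Matrix.one_mul, Matrix.mul_assoc, conjTranspose_mul_eigenvectorUnitary, Matrix.mul_one]
  have htr : P.trace = (Uᴴ * P * U).trace := by
    rw [trace_mul_comm, ← Matrix.mul_assoc, eigenvectorUnitary_mul_conjTranspose, Matrix.one_mul]
  rw [traceNorm_eq_sum_abs_eigenvalues hH, htr, Matrix.trace, Complex.re_sum]
  refine Finset.sum_le_sum fun i _ => abs_le.mpr ?_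
  have e₁ := (Complex.le_def.mp ((h₁.conjTranspose_mul_mul_same U).diag_nonneg (i := i))).1
  have e₂ := (Complex.le_def.mp ((h₂.conjTranspose_mul_mul_same U).diag_nonneg (i := i))).1
  rw [Matrix.mul_sub, Matrix.sub_mul, hdiag] at e₁
  rw [Matrix.mul_add, Matrix.add_mul, hdiag] at e₂
  simp only [Matrix.sub_apply, Matrix.add_apply, diagonal_apply_eq, Complex.sub_re, Complex.add_re,
    Complex.ofReal_re, Complex.zero_re] at e₁ e₂
  simp only [diag_apply]
  constructor <;> linarith

lemma exists_forall_le_posSemidef_smul_one_add {H : Matrix n n ℂ} (hH : H.IsHermitian) :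
    ∃ c : ℝ, 0 ≤ c ∧ ∀ t : ℝ, c ≤ t → ((t : ℂ) • (1 : Matrix n n ℂ) + H).PosSemidef := by
  refine ⟨∑ i, |hH.eigenvalues i|, Finset.sum_nonneg fun _ _ => abs_nonneg _, fun t ht => ?_⟩
  convert posSemidef_eigenvectorUnitary_conj hH
      (d := fun i => t + hH.eigenvalues i)
      (fun i => ?_) using 1
  · conv_lhs => rw [hH.eq_mul_diagonal_mul, ← eigenvectorUnitary_mul_conjTranspose hH]
    rw [← Matrix.smul_mul, ← Matrix.add_mul]
    congr 1
    ext i j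
    simp [mul_diagonal]
    ring
  · have := Finset.single_le_sum (f := fun i => |hH.eigenvalues i|) (fun _ _ => abs_nonneg _)
      (Finset.mem_univ i)
    linarith [neg_abs_le (hH.eigenvalues i)]

lemma trace_mul_conjTranspose_re {m : Type*} [Fintype m] {A B : Matrix m m ℂ} (hB : B.IsHermitian) :
    ((Aᴴ * B).trace).re = ((A * B).trace).re := by
  rw [← hB.eq, ← conjTranspose_mul, trace_conjTranspose, trace_mul_comm, hB.eq]
  simp

lemma posSemidef_of_sub_of_add {m : Type*} {X Y : Matrix m m ℂ} (h : (Y - X).PosSemidef)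
    (h' : (Y + X).PosSemidef) : Y.PosSemidef := by
  convert (h.add h').smul (a := (1 / 2 : ℝ)) (by norm_num) using 1
  module

lemma eq_of_forall_trace_mul_re {m : Type*} [Fintype m] {A B : Matrix m m ℂ}
    (h : ∀ X : Matrix m m ℂ, ((A * X).trace).re = ((B * X).trace).re) : A = B := by
  rw [← sub_eq_zero, ← trace_mul_conjTranspose_self_eq_zero_iff]
  have h0 := (posSemidef_self_mul_conjTranspose (A - B)).trace_nonneg
  refine Complex.ext ?_ (Complex.le_def.mp h0).2.symm
  simp [Matrix.sub_mul, h]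

/-- A real functional nonnegative on matrices with positive semidefinite Hermitian part is the
pairing with a positive semidefinite matrix. -/
lemma exists_posSemidef_trace_representation (φ : Matrix n n ℂ →ₗ[ℝ] ℝ)
    (hφ : ∀ X, (X + Xᴴ).PosSemidef → 0 ≤ φ X) :
    ∃ M : Matrix n n ℂ, M.PosSemidef ∧ ∀ X, φ X = ((M * X).trace).re := by
  let M : Matrix n n ℂ := of fun j i =>
    (φ (single i j 1) : ℂ) - Complex.I * (φ (single i j Complex.I) : ℂ)
  have hrep (X : Matrix n n ℂ) : φ X = ((M * X).trace).re := by
    have hs (i j : n) (z : ℂ) : single i j z =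
        z.re • single i j (1 : ℂ) + z.im • single i j Complex.I := by
      rw [smul_single, smul_single, ← single_add]
      congr 1
      apply Complex.ext <;> simp
    conv_lhs => rw [matrix_eq_sum_single X]
    simp only [map_sum, Matrix.trace, diag_apply, mul_apply, Complex.re_sum]
    rw [Finset.sum_comm]
    refine Finset.sum_congr rfl fun i _ => Finset.sum_congr rfl fun j _ => ?_
    rw [hs, map_add, map_smul, map_smul]
    simp [M]
    ring
  have hconj (X : Matrix n n ℂ) : φ Xᴴ = φ X := by
    have h1 := hφ (Xᴴ - X) (by simp [Matrix.PosSemidef.zero])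
    have h2 := hφ (X - Xᴴ) (by simp [Matrix.PosSemidef.zero])
    rw [map_sub] at h1 h2
    linarith
  have hM : M.IsHermitian := by
    refine eq_of_forall_trace_mul_re fun X => ?_
    rw [← hrep X, ← hconj X, hrep, ← Complex.conj_re, ← Complex.star_def, ← trace_conjTranspose,
      conjTranspose_mul, conjTranspose_conjTranspose, trace_mul_comm]
  refine ⟨M, PosSemidef.of_dotProduct_mulVec_nonneg hM fun v => ?_, hrep⟩
  have hv := posSemidef_vecMulVec_self_star v
  have h := hφ _ (hv.add hv.conjTranspose)
  rw [hrep, trace_mul_comm, vecMulVec_mul, trace_vecMulVec, dotProduct_comm,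
    ← dotProduct_mulVec] at h
  exact Complex.le_def.mpr ⟨h, (hM.im_star_dotProduct_mulVec_self v).symm⟩

section PartialTranspose

variable {a b : Type*}

@[simp] lemma ptB_apply (X : Matrix (a × b) (a × b) ℂ) (p q : a × b) :
    ptB X p q = X (p.1, q.2) (q.1, p.2) := rfl

@[simp] lemma ptB_ptB (X : Matrix (a × b) (a × b) ℂ) : ptB (ptB X) = X := rfl

lemma ptB_add (X Y : Matrix (a × b) (a × b) ℂ) : ptB (X + Y) = ptB X + ptB Y := rfl

lemma ptB_sub (X Y : Matrix (a × b) (a × b) ℂ) : ptB (X - Y) = ptB X - ptB Y := rfl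

lemma ptB_smul {R : Type*} [SMul R ℂ] (r : R) (X : Matrix (a × b) (a × b) ℂ) :
    ptB (r • X) = r • ptB X := rfl

lemma ptB_conjTranspose (X : Matrix (a × b) (a × b) ℂ) : ptB Xᴴ = (ptB X)ᴴ := rfl

lemma ptB_one [DecidableEq a] [DecidableEq b] : ptB (1 : Matrix (a × b) (a × b) ℂ) = 1 := by
  ext ⟨i, j⟩ ⟨i', j'⟩
  simp [one_apply, eq_comm]

lemma isHermitian_ptB {X : Matrix (a × b) (a × b) ℂ} (hX : X.IsHermitian) :
    (ptB X).IsHermitian := by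
  rw [IsHermitian, ← ptB_conjTranspose, hX.eq]

lemma trace_ptB_mul [Fintype a] [Fintype b] (X Y : Matrix (a × b) (a × b) ℂ) :
    (ptB X * Y).trace = (X * ptB Y).trace := by
  simp only [Matrix.trace, diag_apply, mul_apply, ptB_apply, Fintype.sum_prod_type]
  refine Finset.sum_congr rfl fun i _ => ?_
  simp_rw [Finset.sum_comm (s := Finset.univ (α := b)) (t := Finset.univ (α := a))]
  exact Finset.sum_congr rfl fun j _ => Finset.sum_comm

end PartialTranspose

section Duality

variable {a b : Type*} [Fintype a] [Fintype b] [DecidableEq a] [DecidableEq b]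

/-- Weak duality. -/
lemma trace_mul_re_le_of_memPPTk {k : ℕ} (hk : 1 ≤ k) {ω σ : Matrix (a × b) (a × b) ℂ}
    (hσ : memPPTk k σ) {t : ℝ} (ht : 0 ≤ t) {α β : ℕ → Matrix (a × b) (a × b) ℂ}
    (hαβ : ∀ i ∈ Finset.Icc 1 k, (α i).PosSemidef ∧ (β i).PosSemidef)
    (h₁ : (ptB (β 1) - ptB (α 1) - ω).PosSemidef)
    (hstep : ∀ i ∈ Finset.Icc 2 k,
      (ptB (β i) - ptB (α i) - (α (i - 1) + β (i - 1))).PosSemidef)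
    (hlast : ((t : ℂ) • (1 : Matrix (a × b) (a × b) ℂ) - (α k + β k)).PosSemidef) :
    ((σ * ω).trace).re ≤ t := by
  obtain ⟨hσ, η, rfl, hη, hηstep, hηlast⟩ := hσ
  obtain ⟨P, hP₁, hP₂, hPtr⟩ := exists_posSemidef_trace_eq_traceNorm
    (isHermitian_ptB (hη k (by simp [hk])))
  have hmove {X Y A B Z : Matrix (a × b) (a × b) ℂ} (hX : X.PosSemidef)
      (hZ : (ptB B - ptB A - Z).PosSemidef) (hA : A.PosSemidef) (hB : B.PosSemidef)
      (h : (Y - ptB X).PosSemidef) (h' : (Y + ptB X).PosSemidef) :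
      ((X * Z).trace).re ≤ ((Y * (A + B)).trace).re := by
    have e₁ := posSemidef_trace_mul_re_nonneg hX hZ
    have e₂ := posSemidef_trace_mul_re_nonneg h hB
    have e₃ := posSemidef_trace_mul_re_nonneg h' hA
    simp only [Matrix.mul_sub, Matrix.mul_add, Matrix.sub_mul, Matrix.add_mul, trace_sub,
      trace_add, trace_ptB_mul, Complex.sub_re, Complex.add_re] at e₁ e₂ e₃ ⊢
    linarith
  have hpos (i : ℕ) (hi : i ∈ Finset.Icc 1 k) : (η i).PosSemidef := by
    obtain ⟨hi₁, hi₂⟩ := Finset.mem_Icc.mp hi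
    obtain rfl | hi₁ := hi₁.eq_or_lt
    · exact hσ
    · obtain ⟨j, rfl⟩ : ∃ j, i = j + 1 := ⟨i - 1, by omega⟩
      have h := hηstep j (Finset.mem_Icc.mpr ⟨by omega, by omega⟩)
      exact posSemidef_of_sub_of_add h.1 h.2
  have hchain (i : ℕ) (hi : 1 ≤ i) : i + 1 ≤ k →
      ((η 1 * ω).trace).re ≤ ((η (i + 1) * (α i + β i)).trace).re := by
    induction i, hi using Nat.le_induction with
    | base =>
      intro hik
      have hab := hαβ 1 (Finset.mem_Icc.mpr ⟨le_rfl, hk⟩)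
      have h := hηstep 1 (Finset.mem_Icc.mpr ⟨by omega, by omega⟩)
      exact hmove hσ h₁ hab.1 hab.2 h.1 h.2
    | succ i hi ih =>
      intro hik
      have hab := hαβ (i + 1) (Finset.mem_Icc.mpr ⟨by omega, by omega⟩)
      have h := hηstep (i + 1) (Finset.mem_Icc.mpr ⟨by omega, by omega⟩)
      exact (ih (by omega)).trans (hmove (hpos _ (Finset.mem_Icc.mpr ⟨by omega, by omega⟩))
        (hstep (i + 1) (Finset.mem_Icc.mpr ⟨by omega, by omega⟩)) hab.1 hab.2 h.1 h.2)
  have hab := hαβ k (Finset.mem_Icc.mpr ⟨hk, le_rfl⟩)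
  have hfinal : ((η 1 * ω).trace).re ≤ ((P * (α k + β k)).trace).re := by
    obtain rfl | hk := hk.eq_or_lt
    · exact hmove hσ h₁ hab.1 hab.2 hP₁ hP₂
    · obtain ⟨j, rfl⟩ : ∃ j, k = j + 1 := ⟨k - 1, by omega⟩
      exact (hchain j (by omega) le_rfl).trans
        (hmove (hpos _ (Finset.mem_Icc.mpr ⟨by omega, le_rfl⟩))
          (hstep (j + 1) (Finset.mem_Icc.mpr ⟨by omega, le_rfl⟩)) hab.1 hab.2 hP₁ hP₂)
  have hP := posSemidef_trace_mul_re_nonneg (posSemidef_of_sub_of_add hP₁ hP₂) hlast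
  rw [Matrix.mul_sub, trace_sub, Matrix.mul_smul, Matrix.mul_one, trace_smul, smul_eq_mul,
    Complex.sub_re, Complex.re_ofReal_mul, hPtr] at hP
  nlinarith

/-- Strong duality, for the homogenized constraints of `memPPTk`. -/
lemma exists_dual_of_forall_le {k : ℕ} (hk : 1 ≤ k) {ω : Matrix (a × b) (a × b) ℂ}
    (hω : ω.IsHermitian) {p : ℝ}
    (h : ∀ x : ℕ → Matrix (a × b) (a × b) ℂ, (∀ j, (x j).IsHermitian) →
      (∀ j ≤ k, (x (j + 1) + ptB (x j)).PosSemidef ∧ (x (j + 1) - ptB (x j)).PosSemidef) →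
      ((x 1 * ω).trace).re ≤ p * (x (k + 1)).trace.re) :
    ∃ α β : ℕ → Matrix (a × b) (a × b) ℂ,
      (∀ i ∈ Finset.Icc 1 k, (α i).PosSemidef ∧ (β i).PosSemidef) ∧
      (ptB (β 1) - ptB (α 1) - ω).PosSemidef ∧
      (∀ i ∈ Finset.Icc 2 k,
        (ptB (β i) - ptB (α i) - (α (i - 1) + β (i - 1))).PosSemidef) ∧
      ((p : ℂ) • (1 : Matrix (a × b) (a × b) ℂ) - (α k + β k)).PosSemidef := by
  let C : PointedCone ℝ ((ℕ → Matrix (a × b) (a × b) ℂ) × (ℕ → Matrix (a × b) (a × b) ℂ)) :=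
    { carrier := {w | ∀ j ≤ k, (w.1 j + (w.1 j)ᴴ).PosSemidef ∧ (w.2 j + (w.2 j)ᴴ).PosSemidef}
      add_mem' := by
        intro v w hv hw j hj
        constructor
        · convert (hv j hj).1.add (hw j hj).1 using 1
          simp only [Prod.fst_add, Pi.add_apply, conjTranspose_add]
          abel
        · convert (hv j hj).2.add (hw j hj).2 using 1
          simp only [Prod.snd_add, Pi.add_apply, conjTranspose_add]
          abel
      zero_mem' := fun j _ => by simp [Matrix.PosSemidef.zero]
      smul_mem' := by
        rintro ⟨r, hr⟩ w hw j hj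
        constructor
        · convert (hw j hj).1.smul hr using 1
          ext
          simp
        · convert (hw j hj).2.smul hr using 1
          ext
          simp }
  let A : (ℕ → Matrix (a × b) (a × b) ℂ) →ₗ[ℝ]
      (ℕ → Matrix (a × b) (a × b) ℂ) × (ℕ → Matrix (a × b) (a × b) ℂ) :=
    { toFun := fun x => (fun j => x (j + 1) + ptB (x j), fun j => x (j + 1) - ptB (x j))
      map_add' := by
        intro x y
        ext j : 2
        · simp only [Pi.add_apply, ptB_add, Prod.mk_add_mk]
          abel
        · simp only [Pi.add_apply, ptB_add, Prod.mk_add_mk]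
          abel
      map_smul' := by
        intro r x
        ext j : 2
        · simp [ptB_smul, smul_add]
        · simp [ptB_smul, smul_sub] }
  let c : (ℕ → Matrix (a × b) (a × b) ℂ) →ₗ[ℝ] ℝ :=
    { toFun := fun x => p * (x (k + 1)).trace.re - ((x 1 * ω).trace).re
      map_add' := by
        intro x y
        simp [Matrix.add_mul]
        ring
      map_smul' := by
        intro r x
        simp
        ring }
  have hc (x : ℕ → Matrix (a × b) (a × b) ℂ) (hx : A x ∈ C) : 0 ≤ c x := by
    have hy := h (fun j => x j + (x j)ᴴ) (fun j => isHermitian_add_transpose_self _)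
      (fun j hj => by
        constructor
        · convert (hx j hj).1 using 1
          simp only [A, LinearMap.coe_mk, AddHom.coe_mk, ptB_add, ptB_conjTranspose,
            conjTranspose_add]
          abel
        · convert (hx j hj).2 using 1
          simp only [A, LinearMap.coe_mk, AddHom.coe_mk, ptB_add, ptB_conjTranspose,
            conjTranspose_sub]
          abel)
    simp only [Matrix.add_mul, trace_add, Complex.add_re, trace_mul_conjTranspose_re hω,
      trace_conjTranspose, Complex.star_def, Complex.conj_re] at hy
    simp only [c, LinearMap.coe_mk, AddHom.coe_mk]
    linarith
  have hAC (w : (ℕ → Matrix (a × b) (a × b) ℂ) × (ℕ → Matrix (a × b) (a × b) ℂ)) :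
      ∃ x, A x + w ∈ C := by
    choose N₁ hN₁ hN₁' using fun j => exists_forall_le_posSemidef_smul_one_add
      (isHermitian_add_transpose_self (w.1 j))
    choose N₂ hN₂ hN₂' using fun j => exists_forall_le_posSemidef_smul_one_add
      (isHermitian_add_transpose_self (w.2 j))
    let s : ℕ → ℝ := fun j => ∑ i ∈ Finset.range j, (N₁ i + N₂ i)
    have hs (j : ℕ) : 0 ≤ s j := Finset.sum_nonneg fun i _ => add_nonneg (hN₁ i) (hN₂ i)
    have hss (j : ℕ) : s (j + 1) = s j + (N₁ j + N₂ j) := Finset.sum_range_succ _ _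
    refine ⟨fun j => (s j : ℂ) • 1, fun j _ => ⟨?_, ?_⟩⟩
    · convert hN₁' j (2 * (s (j + 1) + s j)) (by linarith [hs j, hss j, hN₁ j, hN₂ j]) using 1
      simp only [A, LinearMap.coe_mk, AddHom.coe_mk, ptB_smul, ptB_one, Prod.fst_add, Pi.add_apply,
        conjTranspose_add, conjTranspose_smul, conjTranspose_one, Complex.star_def,
        Complex.conj_ofReal]
      push_cast
      module
    · convert hN₂' j (2 * (s (j + 1) - s j)) (by linarith [hss j, hN₁ j, hN₂ j]) using 1
      simp only [A, LinearMap.coe_mk, AddHom.coe_mk, ptB_smul, ptB_one, Prod.snd_add, Pi.add_apply,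
        conjTranspose_add, conjTranspose_sub, conjTranspose_smul, conjTranspose_one,
        Complex.star_def, Complex.conj_ofReal]
      push_cast
      module
  obtain ⟨φ, hφ, hφc⟩ := exists_nonneg_representation C A c hc hAC
  choose α hα hαφ using fun j => exists_posSemidef_trace_representation
    (φ ∘ₗ LinearMap.inl ℝ _ _ ∘ₗ LinearMap.single ℝ (fun _ : ℕ => Matrix (a × b) (a × b) ℂ) j)
    (fun X hX => by
      refine hφ _ fun i _ => ?_
      by_cases hij : i = j
      · subst hij
        simp [hX, Matrix.PosSemidef.zero]
      · simp [hij, Matrix.PosSemidef.zero])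
  choose β hβ hβφ using fun j => exists_posSemidef_trace_representation
    (φ ∘ₗ LinearMap.inr ℝ _ _ ∘ₗ LinearMap.single ℝ (fun _ : ℕ => Matrix (a × b) (a × b) ℂ) j)
    (fun X hX => by
      refine hφ _ fun i _ => ?_
      by_cases hij : i = j
      · subst hij
        simp [hX, Matrix.PosSemidef.zero]
      · simp [hij, Matrix.PosSemidef.zero])
  have hmem (w : (ℕ → Matrix (a × b) (a × b) ℂ) × (ℕ → Matrix (a × b) (a × b) ℂ))
      (h₁ : ∀ j ≤ k, w.1 j = 0) (h₂ : ∀ j ≤ k, w.2 j = 0) : 0 ≤ φ w :=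
    hφ w fun j hj => by simp [h₁ j hj, h₂ j hj, Matrix.PosSemidef.zero]
  have hαk : α (k + 1) = 0 := by
    refine eq_of_forall_trace_mul_re fun X => ?_
    have hX (X : Matrix (a × b) (a × b) ℂ) : 0 ≤ ((α (k + 1) * X).trace).re := by
      rw [← hαφ]
      exact hmem _ (fun j hj => by simp [(Nat.lt_succ_of_le hj).ne]) (fun j _ => by simp)
    have h1 := hX X
    have h2 := hX (-X)
    simp only [Matrix.mul_neg, trace_neg, Complex.neg_re] at h2
    simp only [Matrix.zero_mul, trace_zero, Complex.zero_re]
    linarith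
  have hβk : β (k + 1) = 0 := by
    refine eq_of_forall_trace_mul_re fun X => ?_
    have hX (X : Matrix (a × b) (a × b) ℂ) : 0 ≤ ((β (k + 1) * X).trace).re := by
      rw [← hβφ]
      exact hmem _ (fun j _ => by simp) (fun j hj => by simp [(Nat.lt_succ_of_le hj).ne])
    have h1 := hX X
    have h2 := hX (-X)
    simp only [Matrix.mul_neg, trace_neg, Complex.neg_re] at h2
    simp only [Matrix.zero_mul, trace_zero, Complex.zero_re]
    linarith
  have hA (m : ℕ) (X : Matrix (a × b) (a × b) ℂ) : A (Pi.single (m + 1) X) =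
      (Pi.single m X + Pi.single (m + 1) (ptB X), Pi.single m X - Pi.single (m + 1) (ptB X)) := by
    have hpt (j : ℕ) : ptB ((Pi.single (m + 1) X : ℕ → Matrix (a × b) (a × b) ℂ) j) =
        (Pi.single (m + 1) (ptB X) : ℕ → Matrix (a × b) (a × b) ℂ) j := by
      by_cases hj : j = m + 1
      · subst hj
        simp
      · simp only [Pi.single_eq_of_ne hj]
        rfl
    have hsucc (j : ℕ) : (Pi.single (m + 1) X : ℕ → Matrix (a × b) (a × b) ℂ) (j + 1) =
        (Pi.single m X : ℕ → Matrix (a × b) (a × b) ℂ) j := by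
      simp [Pi.single_apply]
    ext j : 2 <;> simp [A, hpt, hsucc]
  have hφA (m : ℕ) (X : Matrix (a × b) (a × b) ℂ) : φ (A (Pi.single (m + 1) X)) =
      (((α m + β m + ptB (α (m + 1)) - ptB (β (m + 1))) * X).trace).re := by
    have hdecomp : A (Pi.single (m + 1) X) =
        LinearMap.inl ℝ _ _ (LinearMap.single ℝ (fun _ : ℕ => Matrix (a × b) (a × b) ℂ) m X) +
        LinearMap.inl ℝ _ _
          (LinearMap.single ℝ (fun _ : ℕ => Matrix (a × b) (a × b) ℂ) (m + 1) (ptB X)) +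
        LinearMap.inr ℝ _ _ (LinearMap.single ℝ (fun _ : ℕ => Matrix (a × b) (a × b) ℂ) m X) -
        LinearMap.inr ℝ _ _
          (LinearMap.single ℝ (fun _ : ℕ => Matrix (a × b) (a × b) ℂ) (m + 1) (ptB X)) := by
      rw [hA]
      simp
    have e₁ := hαφ m X
    have e₂ := hαφ (m + 1) (ptB X)
    have e₃ := hβφ m X
    have e₄ := hβφ (m + 1) (ptB X)
    simp only [LinearMap.comp_apply] at e₁ e₂ e₃ e₄
    rw [hdecomp, map_sub, map_add, map_add, e₁, e₂, e₃, e₄]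
    simp only [Matrix.sub_mul, Matrix.add_mul, trace_sub, trace_add, trace_ptB_mul,
      Complex.sub_re, Complex.add_re]
    ring
  have hcoef (m : ℕ) : α m + β m + ptB (α (m + 1)) - ptB (β (m + 1)) =
      (if m = k then (p : ℂ) • (1 : Matrix (a × b) (a × b) ℂ) else 0) -
          (if m = 0 then ω else 0) := by
    refine eq_of_forall_trace_mul_re fun X => ?_
    rw [← hφA, ← hφc]
    by_cases hmk : m = k
    · have hm0 : m ≠ 0 := by omega
      subst hmk
      simp [c, hm0]
    · by_cases hm0 : m = 0
      · subst hm0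
        simp [c, Ne.symm hmk, hmk, trace_mul_comm ω]
      · simp [c, hm0, hmk, Ne.symm hmk]
  refine ⟨α, β, fun i _ => ⟨hα i, hβ i⟩, ?_, fun i hi => ?_, ?_⟩
  · have h0 := hcoef 0
    rw [if_neg (by omega), if_pos rfl] at h0
    convert (hα 0).add (hβ 0) using 1
    linear_combination (norm := module) (-1 : ℂ) • h0
  · obtain ⟨hi₁, hi₂⟩ := Finset.mem_Icc.mp hi
    have hi0 := hcoef (i - 1)
    rw [if_neg (by omega), if_neg (by omega), Nat.sub_add_cancel (by omega)] at hi0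
    convert Matrix.PosSemidef.zero (n := a × b) (R := ℂ) using 1
    linear_combination (norm := module) (-1 : ℂ) • hi0
  · have hk0 := hcoef k
    rw [if_pos rfl, if_neg (by omega), hαk, hβk] at hk0
    convert Matrix.PosSemidef.zero (n := a × b) (R := ℂ) using 1
    have hz : ptB (0 : Matrix (a × b) (a × b) ℂ) = 0 := rfl
    rw [hz] at hk0
    linear_combination (norm := module) (-1 : ℂ) • hk0

end Duality

/-- A nonnegative multiple of a feasible chain with normalised last trace lies in `PPT_k`. -/
lemma memPPTk_smul {a b : Type*} [Fintype a] [Fintype b] [DecidableEq a] [DecidableEq b] {k : ℕ}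
    {x : ℕ → Matrix (a × b) (a × b) ℂ} (hx : ∀ j, (x j).IsHermitian)
    (h : ∀ j ≤ k, (x (j + 1) + ptB (x j)).PosSemidef ∧ (x (j + 1) - ptB (x j)).PosSemidef)
    {s : ℝ} (hs : 0 ≤ s) (hsx : s * (x (k + 1)).trace.re ≤ 1) : memPPTk k ((s : ℂ) • x 1) := by
  have hsC : (0 : ℂ) ≤ (s : ℂ) := by exact_mod_cast hs
  have hpsd (j : ℕ) (hj : j ≤ k) :
      ((s : ℂ) • x (j + 1) + ptB ((s : ℂ) • x j)).PosSemidef ∧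
        ((s : ℂ) • x (j + 1) - ptB ((s : ℂ) • x j)).PosSemidef := by
    rw [ptB_smul, ← smul_add, ← smul_sub]
    exact ⟨(h j hj).1.smul hsC, (h j hj).2.smul hsC⟩
  have hherm (j : ℕ) : ((s : ℂ) • x j).IsHermitian := by
    rw [IsHermitian, conjTranspose_smul, hx j, Complex.star_def, Complex.conj_ofReal]
  refine ⟨(posSemidef_of_sub_of_add (h 0 k.zero_le).2 (h 0 k.zero_le).1).smul hsC,
    fun j => (s : ℂ) • x j, rfl, fun j _ => hherm j, fun j hj => ?_, ?_⟩
  · have hj := hpsd j ((Finset.mem_Icc.mp hj).2.trans k.pred_le)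
    exact ⟨hj.2, hj.1⟩
  · refine (traceNorm_le_of_posSemidef (isHermitian_ptB (hherm k)) (hpsd k le_rfl).2
      (hpsd k le_rfl).1).trans ?_
    simpa using hsx

lemma memPPTk_zero {a b : Type*} [Fintype a] [Fintype b] [DecidableEq a] [DecidableEq b] {k : ℕ} :
    memPPTk k (0 : Matrix (a × b) (a × b) ℂ) := by
  have hz : ptB (0 : Matrix (a × b) (a × b) ℂ) = 0 := rfl
  simpa using memPPTk_smul (k := k) (x := 0) (s := 0) (fun j => isHermitian_zero)
    (fun j _ => by simp [hz, Matrix.PosSemidef.zero]) le_rfl (by simp)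

/-- dual SDP expression for the support function of `PPT_k(A:B)`. -/
theorem suppFn_pptk_dual {dA dB : ℕ} (k : ℕ) (hk : 2 ≤ k)
    (ω : Matrix (Fin dA × Fin dB) (Fin dA × Fin dB) ℂ) (hω : ω.IsHermitian) :
    sSup {r : ℝ | ∃ σ : Matrix (Fin dA × Fin dB) (Fin dA × Fin dB) ℂ,
        memPPTk k σ ∧ r = ((σ * ω).trace).re} =
      sInf {t : ℝ | 0 ≤ t ∧
        ∃ α β : ℕ → Matrix (Fin dA × Fin dB) (Fin dA × Fin dB) ℂ,
          (∀ i ∈ Finset.Icc 1 k, (α i).PosSemidef ∧ (β i).PosSemidef) ∧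
          (ptB (β 1) - ptB (α 1) - ω).PosSemidef ∧
          (∀ i ∈ Finset.Icc 2 k,
            (ptB (β i) - ptB (α i) - (α (i - 1) + β (i - 1))).PosSemidef) ∧
          ((t : ℂ) • (1 : Matrix (Fin dA × Fin dB) (Fin dA × Fin dB) ℂ) -
            (α k + β k)).PosSemidef} := by
  set S := {r : ℝ | ∃ σ : Matrix (Fin dA × Fin dB) (Fin dA × Fin dB) ℂ,
    memPPTk k σ ∧ r = ((σ * ω).trace).re} with hS
  have h0 : (0 : ℝ) ∈ S := ⟨0, memPPTk_zero, by simp⟩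
  obtain ⟨c, hc, hcω⟩ := exists_forall_le_posSemidef_smul_one_add hω.neg
  have hz : ptB (0 : Matrix (Fin dA × Fin dB) (Fin dA × Fin dB) ℂ) = 0 := rfl
  have hdual : ∃ α β : ℕ → Matrix (Fin dA × Fin dB) (Fin dA × Fin dB) ℂ,
      (∀ i ∈ Finset.Icc 1 k, (α i).PosSemidef ∧ (β i).PosSemidef) ∧
      (ptB (β 1) - ptB (α 1) - ω).PosSemidef ∧
      (∀ i ∈ Finset.Icc 2 k,
        (ptB (β i) - ptB (α i) - (α (i - 1) + β (i - 1))).PosSemidef) ∧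
      ((c : ℂ) • (1 : Matrix (Fin dA × Fin dB) (Fin dA × Fin dB) ℂ) -
        (α k + β k)).PosSemidef := by
    have hcC : (0 : ℂ) ≤ (c : ℂ) := by exact_mod_cast hc
    refine ⟨0, fun _ => (c : ℂ) • 1, fun i _ => ⟨.zero, Matrix.PosSemidef.one.smul hcC⟩, ?_,
      fun i _ => ?_, ?_⟩
    · simpa [hz, ptB_smul, ptB_one, sub_eq_add_neg] using hcω c le_rfl
    · simp [hz, ptB_smul, ptB_one, Matrix.PosSemidef.zero]
    · simp [Matrix.PosSemidef.zero]
  obtain ⟨α₀, β₀, hαβ, h₁, hstep, hlast⟩ := hdual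
  have hbdd : BddAbove S := by
    refine ⟨c, ?_⟩
    rintro _ ⟨σ, hσ, rfl⟩
    exact trace_mul_re_le_of_memPPTk (by omega) hσ hc hαβ h₁ hstep hlast
  have hp : 0 ≤ sSup S := le_csSup hbdd h0
  refine le_antisymm (csSup_le ⟨0, h0⟩ ?_) (csInf_le ⟨0, fun t ht => ht.1⟩ ⟨hp, ?_⟩)
  · rintro _ ⟨σ, hσ, rfl⟩
    refine le_csInf ⟨c, hc, α₀, β₀, hαβ, h₁, hstep, hlast⟩ ?_
    rintro t ⟨ht, α, β, hαβ, h₁, hstep, hlast⟩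
    exact trace_mul_re_le_of_memPPTk (by omega) hσ ht hαβ h₁ hstep hlast
  · refine exists_dual_of_forall_le (by omega) hω fun x hx hxk => ?_
    have hle {s : ℝ} (hs : 0 ≤ s) (hsx : s * (x (k + 1)).trace.re ≤ 1) :
        s * ((x 1 * ω).trace).re ≤ sSup S :=
      le_csSup hbdd ⟨_, memPPTk_smul hx hxk hs hsx, by simp⟩
    have hτ : 0 ≤ (x (k + 1)).trace.re := by
      have := (posSemidef_of_sub_of_add (hxk k le_rfl).2 (hxk k le_rfl).1).trace_nonneg
      exact (Complex.le_def.mp this).1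
    rcases hτ.eq_or_lt with hτ | hτ
    · rw [← hτ, mul_zero]
      by_contra! hr
      have := hle (s := (sSup S + 1) / ((x 1 * ω).trace).re) (by positivity) (by simp [← hτ])
      rw [div_mul_cancel₀ _ hr.ne'] at this
      linarith
    · have := hle (inv_nonneg.mpr hτ.le) (inv_mul_cancel₀ hτ.ne').le
      rwa [inv_mul_le_iff₀ hτ, mul_comm] at this

end QIT
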